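/- There is no primitive isometric embedding of the rank-16 lattice (U ⊕ U(3) ⊕ E6 ⊕ A2^{⊕3})(−1) into the K3 lattice U^{⊕3} ⊕ E8(−1)^{⊕2}. -/

import Mathlib

open Matrix

/-- Gram matrix of the hyperbolic plane `U`. -/
def gramU : Matrix (Fin 2) (Fin 2) ℤ := !![0, 1; 1, 0]

/-- Gram matrix of `U(3)`. -/
def gramU3 : Matrix (Fin 2) (Fin 2) ℤ := !![0, 3; 3, 0]

/-- Gram matrix of the root lattice `A₂`. -/
def gramA2 : Matrix (Fin 2) (Fin 2) ℤ := !![2, -1; -1, 2]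

/-- Gram matrix of the root lattice `E₆` (standard Cartan matrix, Bourbaki numbering). -/
def gramE6 : Matrix (Fin 6) (Fin 6) ℤ :=
  !![ 2,  0, -1,  0,  0,  0;
      0,  2,  0, -1,  0,  0;
     -1,  0,  2, -1,  0,  0;
      0, -1, -1,  2, -1,  0;
      0,  0,  0, -1,  2, -1;
      0,  0,  0,  0, -1,  2]

/-- Gram matrix of the root lattice `E₈` (standard Cartan matrix, Bourbaki numbering). -/
def gramE8 : Matrix (Fin 8) (Fin 8) ℤ :=
  !![ 2,  0, -1,  0,  0,  0,  0,  0;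
      0,  2,  0, -1,  0,  0,  0,  0;
     -1,  0,  2, -1,  0,  0,  0,  0;
      0, -1, -1,  2, -1,  0,  0,  0;
      0,  0,  0, -1,  2, -1,  0,  0;
      0,  0,  0,  0, -1,  2, -1,  0;
      0,  0,  0,  0,  0, -1,  2, -1;
      0,  0,  0,  0,  0,  0, -1,  2]

/-- Rank-22 index type for the K3 lattice `U^{⊕3} ⊕ E₈(-1)^{⊕2}`. -/
abbrev IK3 : Type := (Fin 2 ⊕ Fin 2) ⊕ (Fin 2 ⊕ (Fin 8 ⊕ Fin 8))

/-- Gram matrix of the K3 lattice `U^{⊕3} ⊕ E₈(-1)^{⊕2}`. -/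
def gramK3 : Matrix IK3 IK3 ℤ :=
  Matrix.fromBlocks (Matrix.fromBlocks gramU 0 0 gramU) 0 0
    (Matrix.fromBlocks gramU 0 0
      (Matrix.fromBlocks (-gramE8) 0 0 (-gramE8)))

/-- Rank-16 index type for the lattice `(U ⊕ U(3) ⊕ E₆ ⊕ A₂^{⊕3})(-1)`. -/
abbrev ISrc : Type := (Fin 2 ⊕ Fin 2) ⊕ (Fin 6 ⊕ (Fin 2 ⊕ (Fin 2 ⊕ Fin 2)))

/-- Gram matrix of the lattice `(U ⊕ U(3) ⊕ E₆ ⊕ A₂^{⊕3})(-1)`. -/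
def gramSrc : Matrix ISrc ISrc ℤ :=
  - (Matrix.fromBlocks (Matrix.fromBlocks gramU 0 0 gramU3) 0 0
      (Matrix.fromBlocks gramE6 0 0
        (Matrix.fromBlocks gramA2 0 0 (Matrix.fromBlocks gramA2 0 0 gramA2))))

/-- If a nondegenerate symmetric form `G` contains an orthogonal sum of a space with Gram matrix `A`
and a totally isotropic space of dimension `b`, and has dimension `a + 2b`, then `det G` is
`(-1)^b det A` up to squares. -/
theorem det_mul_neg_one_pow_eq_sq_mul_det {F m a b : Type*} [Field F] [Fintype m] [DecidableEq m]
    [Fintype a] [DecidableEq a] [Fintype b] [DecidableEq b]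
    (e : m ≃ a ⊕ (b ⊕ b)) (G : Matrix m m F) (hG : Gᵀ = G) (hdet : IsUnit G.det)
    (C : Matrix m a F) (R : Matrix m b F) (L : Matrix b m F) (A : Matrix a a F)
    (hLC : L * C = 0) (hLR : L * R = 1)
    (hCC : Cᵀ * G * C = A) (hCR : Cᵀ * G * R = 0) (hRR : Rᵀ * G * R = 0) :
    ∃ d : F, A.det * (-1) ^ Fintype.card b = d ^ 2 * G.det := by
  set Y : Matrix m b F := G⁻¹ * Lᵀ
  have hGY : G * Y = Lᵀ := Matrix.mul_nonsing_inv_cancel_left G Lᵀ hdet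
  have hYG : Yᵀ * G = L := by
    simpa [Matrix.transpose_mul, hG] using congrArg Matrix.transpose hGY
  have hRC : Rᵀ * G * C = 0 := by
    have := congrArg Matrix.transpose hCR
    simpa [Matrix.transpose_mul, hG, Matrix.mul_assoc] using this
  have hCY : Cᵀ * G * Y = 0 := by
    rw [Matrix.mul_assoc, hGY, ← Matrix.transpose_mul, hLC, Matrix.transpose_zero]
  have hRY : Rᵀ * G * Y = 1 := by
    rw [Matrix.mul_assoc, hGY, ← Matrix.transpose_mul, hLR, Matrix.transpose_one]
  set Z : Matrix m (a ⊕ (b ⊕ b)) F := Matrix.fromCols C (Matrix.fromCols R Y) with hZ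
  have hgram : Zᵀ * G * Z =
      Matrix.fromBlocks A 0 0 (Matrix.fromBlocks 0 1 1 (L * Y)) := by
    simp only [hZ, Matrix.transpose_fromCols, Matrix.fromRows_mul, Matrix.mul_fromCols,
      hYG, hCC, hCR, hCY, hRC, hRR, hRY, hLC, hLR]
    ext (i | i | i) (j | j | j) <;> simp
  have hhyp : (Matrix.fromBlocks (0 : Matrix b b F) 1 1 (L * Y)).det =
      (-1) ^ Fintype.card b := by
    have h : Matrix.fromBlocks 1 1 0 1 * Matrix.fromBlocks (0 : Matrix b b F) 1 1 (L * Y) =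
        Matrix.fromBlocks 1 (1 + L * Y) 1 (L * Y) := by
      simp [Matrix.fromBlocks_multiply]
    have h' := congrArg Matrix.det h
    rw [Matrix.det_mul, Matrix.det_fromBlocks_zero₂₁, Matrix.det_fromBlocks_one₁₁] at h'
    simpa [Matrix.det_neg] using h'
  refine ⟨(Z.submatrix id e).det, ?_⟩
  have h : (Z.submatrix id e)ᵀ * G * Z.submatrix id e = (Zᵀ * G * Z).submatrix e e := by
    ext i j
    simp [Matrix.mul_apply]
  have h' := congrArg Matrix.det h
  rw [Matrix.det_mul, Matrix.det_mul, Matrix.det_transpose, Matrix.det_submatrix_equiv_self,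
    hgram, Matrix.det_fromBlocks_zero₂₁, hhyp] at h'
  rw [← h']
  ring

/-- The reduction of a primitive embedding modulo a prime is split injective. -/
theorem exists_leftInverse_map_intCast {m n : Type*} [Fintype m] [DecidableEq m] [Fintype n]
    [DecidableEq n] (p : ℕ) [Fact p.Prime] (f : (n → ℤ) →ₗ[ℤ] (m → ℤ))
    (hinj : Function.Injective f)
    (hprim : ∀ (x : m → ℤ) (k : ℤ), k ≠ 0 → k • x ∈ LinearMap.range f → x ∈ LinearMap.range f) :
    ∃ L : Matrix n m (ZMod p), L * (LinearMap.toMatrix' f).map (Int.castRingHom (ZMod p)) = 1 := by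
  set P := (LinearMap.toMatrix' f).map (Int.castRingHom (ZMod p)) with hP
  have hker : LinearMap.ker (Matrix.toLin' P) = ⊥ := by
    rw [LinearMap.ker_eq_bot']
    intro v hv
    choose w hw using fun i => ZMod.intCast_surjective (v i)
    have hfw : ∀ i, (p : ℤ) ∣ f w i := by
      intro i
      rw [← ZMod.intCast_zmod_eq_zero_iff_dvd]
      have h1 := congrFun hv i
      rw [← LinearMap.toMatrix'_mulVec f w]
      simpa [hP, Matrix.mulVec, dotProduct, ← hw] using h1
    choose x hx using hfw
    have hp : (p : ℤ) ≠ 0 := Int.natCast_ne_zero.mpr (Fact.out : p.Prime).ne_zero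
    obtain ⟨y, rfl⟩ := hprim x p hp ⟨w, funext hx⟩
    have hwy : w = (p : ℤ) • y := hinj (by rw [map_smul]; exact funext hx)
    ext i
    simp [← hw, hwy]
  obtain ⟨g, hg⟩ := LinearMap.exists_leftInverse_of_injective _ hker
  refine ⟨LinearMap.toMatrix' g, ?_⟩
  rw [← LinearMap.toMatrix'_toLin' P, ← LinearMap.toMatrix'_comp, hg, LinearMap.toMatrix'_id]

/-- The basis vectors of the source lattice spanning a copy of `(U ⊕ D₅ ⊕ A₁^{⊕3})(-1)`. -/
def nondegIndex : Fin 2 ⊕ (Fin 5 ⊕ Fin 3) → ISrc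
  | .inl i => .inl (.inl i)
  | .inr (.inl i) => .inr (.inl i.castSucc)
  | .inr (.inr 0) => .inr (.inr (.inl 0))
  | .inr (.inr 1) => .inr (.inr (.inr (.inl 0)))
  | .inr (.inr 2) => .inr (.inr (.inr (.inr 0)))

/-- The matrix whose columns are a basis of a complement of the radical of the source lattice modulo 3. -/
def nondegPart : Matrix ISrc (Fin 2 ⊕ (Fin 5 ⊕ Fin 3)) (ZMod 3) :=
  (1 : Matrix ISrc ISrc (ZMod 3)).submatrix id nondegIndex

/-- A basis of the radical of the source lattice modulo 3. -/
def radicalBasis : Fin 6 → ISrc → ZMod 3 :=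
  ![Sum.elim (Sum.elim 0 ![1, 0]) 0,
    Sum.elim (Sum.elim 0 ![0, 1]) 0,
    Sum.elim 0 (Sum.elim ![1, 0, 2, 0, 1, 2] 0),
    Sum.elim 0 (Sum.elim 0 (Sum.elim ![1, 2] 0)),
    Sum.elim 0 (Sum.elim 0 (Sum.elim 0 (Sum.elim ![1, 2] 0))),
    Sum.elim 0 (Sum.elim 0 (Sum.elim 0 (Sum.elim 0 ![1, 2])))]

/-- The matrix with columns `radicalBasis`. -/
def radicalPart : Matrix ISrc (Fin 6) (ZMod 3) := (Matrix.of radicalBasis)ᵀ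

/-- The projection onto the radical along `nondegPart`. -/
def radicalProj : Matrix (Fin 6) ISrc (ZMod 3) :=
  Matrix.of
  ![Sum.elim (Sum.elim 0 ![1, 0]) 0,
    Sum.elim (Sum.elim 0 ![0, 1]) 0,
    Sum.elim 0 (Sum.elim ![0, 0, 0, 0, 0, 2] 0),
    Sum.elim 0 (Sum.elim 0 (Sum.elim ![0, 2] 0)),
    Sum.elim 0 (Sum.elim 0 (Sum.elim 0 (Sum.elim ![0, 2] 0))),
    Sum.elim 0 (Sum.elim 0 (Sum.elim 0 (Sum.elim 0 ![0, 2])))]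

theorem radicalProj_mul_nondegPart : radicalProj * nondegPart = 0 := by decide +kernel

theorem radicalProj_mul_radicalPart : radicalProj * radicalPart = 1 := by decide +kernel

theorem gramSrc_mul_radicalPart :
    gramSrc.map (Int.castRingHom (ZMod 3)) * radicalPart = 0 := by decide +kernel

/-- Gram matrix of the root lattice `D₅`, as the first five nodes of `E₆`, modulo 3. -/
def gramD5 : Matrix (Fin 5) (Fin 5) (ZMod 3) :=
  !![ 2,  0, -1,  0,  0;
      0,  2,  0, -1,  0;
     -1,  0,  2, -1,  0;
      0, -1, -1,  2, -1;
      0,  0,  0, -1,  2]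

theorem gram_nondegPart :
    nondegPartᵀ * gramSrc.map (Int.castRingHom (ZMod 3)) * nondegPart =
      Matrix.fromBlocks !![0, -1; -1, 0] 0 0 (Matrix.fromBlocks (-gramD5) 0 0 1) := by
  decide +kernel

theorem det_gram_nondegPart :
    (nondegPartᵀ * gramSrc.map (Int.castRingHom (ZMod 3)) * nondegPart).det = 1 := by
  have hD : (-gramD5).det = -1 := by decide +kernel
  rw [gram_nondegPart, Matrix.det_fromBlocks_zero₂₁, Matrix.det_fromBlocks_zero₂₁, hD,
    Matrix.det_fin_two_of, Matrix.det_one]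
  decide

theorem gramK3_transpose : gramK3ᵀ = gramK3 := by decide +kernel

/-- The inverse of the Gram matrix of `E₈` modulo 3. -/
def gramE8Inv : Matrix (Fin 8) (Fin 8) (ZMod 3) :=
  !![1, 2, 1, 1, 2, 0, 1, 2;
      2, 2, 1, 0, 0, 0, 0, 0;
      1, 1, 2, 2, 1, 0, 2, 1;
      1, 0, 2, 0, 0, 0, 0, 0;
      2, 0, 1, 0, 2, 0, 1, 2;
      0, 0, 0, 0, 0, 0, 2, 1;
      1, 0, 2, 0, 1, 2, 0, 0;
      2, 0, 1, 0, 2, 1, 0, 2]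

theorem gramE8_mul_gramE8Inv :
    gramE8.map (Int.castRingHom (ZMod 3)) * gramE8Inv = 1 := by decide +kernel

theorem intCast_det_gramK3 : ((gramK3.det : ℤ) : ZMod 3) = -1 := by
  have hE : ((gramE8.det : ℤ) : ZMod 3) ≠ 0 := by
    intro h
    have h1 := congrArg Matrix.det gramE8_mul_gramE8Inv
    rw [Matrix.det_mul, ← RingHom.mapMatrix_apply, ← RingHom.map_det, eq_intCast, h,
      zero_mul, Matrix.det_one] at h1
    exact zero_ne_one h1
  have hU : gramU.det = -1 := by decide
  have hsq : ∀ x : ZMod 3, x ≠ 0 → x * x = 1 := by decide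
  rw [gramK3, Matrix.det_fromBlocks_zero₂₁, Matrix.det_fromBlocks_zero₂₁,
    Matrix.det_fromBlocks_zero₂₁, Matrix.det_fromBlocks_zero₂₁, Matrix.det_neg, hU]
  simp [hsq _ hE]

/-- There is no primitive isometric embedding of the rank-16 lattice
`(U ⊕ U(3) ⊕ E₆ ⊕ A₂^{⊕3})(-1)` into the K3 lattice `U^{⊕3} ⊕ E₈(-1)^{⊕2}`. -/
theorem stmt_9 :
    ¬ ∃ f : (ISrc → ℤ) →ₗ[ℤ] (IK3 → ℤ),
        Function.Injective f ∧
        (∀ v w : ISrc → ℤ, f v ⬝ᵥ gramK3.mulVec (f w) = v ⬝ᵥ gramSrc.mulVec w) ∧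
        -- primitivity: the cokernel of f is torsion-free
        (∀ (x : IK3 → ℤ) (n : ℤ), n ≠ 0 → n • x ∈ LinearMap.range f →
          x ∈ LinearMap.range f) := by
  rintro ⟨f, hinj, hform, hprim⟩
  obtain ⟨L, hL⟩ := exists_leftInverse_map_intCast 3 f hinj hprim
  set φ := Int.castRingHom (ZMod 3)
  set P := (LinearMap.toMatrix' f).map φ with hP
  have hgram : Pᵀ * gramK3.map φ * P = gramSrc.map φ := by
    have h : (LinearMap.toMatrix' f)ᵀ * gramK3 * LinearMap.toMatrix' f = gramSrc := by
      refine Matrix.toBilin'.injective (LinearMap.ext₂ fun v w => ?_)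
      rw [Matrix.toBilin'_apply', Matrix.toBilin'_apply', ← hform v w,
        ← LinearMap.toMatrix'_mulVec f v, ← LinearMap.toMatrix'_mulVec f w,
        ← Matrix.mulVec_mulVec, ← Matrix.mulVec_mulVec, Matrix.dotProduct_mulVec,
        Matrix.vecMul_transpose]
    rw [← h, Matrix.map_mul, Matrix.map_mul, hP, Matrix.transpose_map]
  have hdet : (gramK3.map φ).det = -1 := by
    rw [← RingHom.mapMatrix_apply, ← RingHom.map_det]
    exact intCast_det_gramK3
  have hpull : ∀ {a b : Type} (S : Matrix ISrc a (ZMod 3)) (T : Matrix ISrc b (ZMod 3)),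
      (P * S)ᵀ * gramK3.map φ * (P * T) = Sᵀ * gramSrc.map φ * T := by
    intro a b S T
    simp only [← hgram, Matrix.transpose_mul, Matrix.mul_assoc]
  obtain ⟨d, hd⟩ := det_mul_neg_one_pow_eq_sq_mul_det
    (Fintype.equivOfCardEq (by decide) : IK3 ≃ (Fin 2 ⊕ (Fin 5 ⊕ Fin 3)) ⊕ (Fin 6 ⊕ Fin 6))
    (gramK3.map φ) (by rw [← Matrix.transpose_map, gramK3_transpose]) (by simp [hdet])
    (P * nondegPart) (P * radicalPart) (radicalProj * L) _
    (by rw [Matrix.mul_assoc, ← Matrix.mul_assoc L, hL, Matrix.one_mul,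
      radicalProj_mul_nondegPart])
    (by rw [Matrix.mul_assoc, ← Matrix.mul_assoc L, hL, Matrix.one_mul,
      radicalProj_mul_radicalPart])
    (hpull _ _)
    (by rw [hpull, Matrix.mul_assoc, gramSrc_mul_radicalPart, Matrix.mul_zero])
    (by rw [hpull, Matrix.mul_assoc, gramSrc_mul_radicalPart, Matrix.mul_zero])
  rw [det_gram_nondegPart, hdet] at hd
  have hne : ∀ d : ZMod 3, 1 * (-1) ^ Fintype.card (Fin 6) ≠ d ^ 2 * -1 := by decide
  exact hne d hd
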